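/- Let $y \sim N_n(\mu, \sigma^2 I)$ and let $g: \mathbb{R}^n \to \mathbb{R}^n$ be Lipschitz continuous with the partial derivatives $\partial g_i/\partial y_i$ existing almost everywhere and integrable. Then $\sum_{i=1}^n \mathrm{cov}(g_i(y), y_i)/\sigma^2 = E[\nabla \cdot g(y)]$, where $\nabla \cdot g = \sum_{i=1}^n \partial g_i/\partial y_i$. -/

import Mathlib

open MeasureTheory ProbabilityTheory
open Filter Topology

/-- The Gaussian density decays faster than any affine function grows. -/
lemma tendsto_mul_gaussianPDFReal_cocompact (m : ℝ) {v : NNReal} (hv : v ≠ 0)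
    {f : ℝ → ℝ} {L : NNReal} (hf : LipschitzWith L f) :
    Tendsto (fun x => f x * gaussianPDFReal m v x) (cocompact ℝ) (𝓝 0) := by
  have hv0 : (0 : ℝ) < v := NNReal.coe_pos.2 (pos_iff_ne_zero.2 hv)
  have ha : (0 : ℝ) < (2 * (v : ℝ))⁻¹ := by positivity
  have hshift : Tendsto (fun x : ℝ => x - m) (cocompact ℝ) (cocompact ℝ) :=
    (Homeomorph.subRight m).isClosedEmbedding.tendsto_cocompact
  have h0 := (tendsto_rpow_abs_mul_exp_neg_mul_sq_cocompact ha 0).comp hshift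
  have h1 := (tendsto_rpow_abs_mul_exp_neg_mul_sq_cocompact ha 1).comp hshift
  have hbound := ((h0.const_mul |f m|).add (h1.const_mul (L : ℝ))).const_mul
    (√(2 * Real.pi * v))⁻¹
  simp only [mul_zero, add_zero] at hbound
  refine squeeze_zero_norm (fun x => ?_) hbound
  have hfx : |f x| ≤ |f m| + L * |x - m| := by
    have h := hf.dist_le_mul x m
    rw [Real.dist_eq, Real.dist_eq] at h
    have := abs_sub_abs_le_abs_sub (f x) (f m)
    linarith
  have hexp : -(x - m) ^ 2 / (2 * v) = -(2 * (v : ℝ))⁻¹ * (x - m) ^ 2 := by ring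
  rw [norm_mul, Real.norm_of_nonneg (gaussianPDFReal_nonneg m v x), Real.norm_eq_abs]
  refine (mul_le_mul_of_nonneg_right hfx (gaussianPDFReal_nonneg m v x)).trans_eq ?_
  simp only [gaussianPDFReal, hexp, Function.comp_apply, Real.rpow_zero, Real.rpow_one]
  ring

lemma hasDerivAt_gaussianPDFReal (m : ℝ) (v : NNReal) (x : ℝ) :
    HasDerivAt (gaussianPDFReal m v) (-((x - m) / v) * gaussianPDFReal m v x) x := by
  have h := (((((hasDerivAt_id x).sub_const m).pow 2).neg.div_const (2 * (v : ℝ))).exp).const_mul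
    (√(2 * Real.pi * v))⁻¹
  refine h.congr_deriv ?_
  simp only [gaussianPDFReal, id, Pi.neg_apply, Pi.pow_apply]
  by_cases hv : (v : ℝ) = 0
  · simp [hv]
  · field_simp
    simp

lemma integrable_gaussianReal_iff {m : ℝ} {v : NNReal} (hv : v ≠ 0) {f : ℝ → ℝ} :
    Integrable f (gaussianReal m v) ↔ Integrable (fun x => gaussianPDFReal m v x * f x) := by
  rw [gaussianReal_of_var_ne_zero m hv, integrable_withDensity_iff_integrable_smul'
    (measurable_gaussianPDF m v) (ae_of_all _ fun _ => gaussianPDF_lt_top)]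
  simp

/-- Stein's identity for Lipschitz functions of a real Gaussian variable. -/
lemma integral_mul_sub_gaussianReal_of_lipschitzWith (m : ℝ) {v : NNReal} (hv : v ≠ 0)
    {f : ℝ → ℝ} {L : NNReal} (hf : LipschitzWith L f) :
    ∫ x, f x * (x - m) ∂gaussianReal m v = v * ∫ x, deriv f x ∂gaussianReal m v := by
  have hv0 : (v : ℝ) ≠ 0 := NNReal.coe_ne_zero.2 hv
  have hid : MemLp id 2 (gaussianReal m v) := memLp_id_gaussianReal' 2 (by simp)
  have hsub : MemLp (fun x : ℝ => x - m) 2 (gaussianReal m v) := hid.sub (memLp_const m)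
  have hfL : MemLp f 2 (gaussianReal m v) := by
    refine ((memLp_const |f 0|).add (hid.norm.const_mul (L : ℝ))).mono'
      hf.continuous.aestronglyMeasurable (ae_of_all _ fun x => ?_)
    have h := hf.dist_le_mul x 0
    rw [Real.dist_eq, Real.dist_eq, sub_zero] at h
    have := abs_sub_abs_le_abs_sub (f x) (f 0)
    simp only [Pi.add_apply, Real.norm_eq_abs, id]
    linarith
  have hprod : Integrable (fun x => f x * (x - m)) (gaussianReal m v) := hfL.integrable_mul hsub
  have hderiv : Integrable (deriv f) (gaussianReal m v) :=
    (integrable_const (L : ℝ)).mono' (measurable_deriv f).aestronglyMeasurable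
      (ae_of_all _ fun x => norm_deriv_le_of_lipschitz hf)
  have hpdf : deriv (gaussianPDFReal m v) = fun x => -((x - m) / v) * gaussianPDFReal m v x :=
    funext fun x => (hasDerivAt_gaussianPDFReal m v x).deriv
  have hsmooth : ContDiff ℝ 1 (gaussianPDFReal m v) := by
    rw [gaussianPDFReal_def]
    fun_prop
  have h1 : Integrable (fun x => deriv f x * gaussianPDFReal m v x) := by
    simpa only [mul_comm] using (integrable_gaussianReal_iff hv).1 hderiv
  have h2 : Integrable (fun x => f x * deriv (gaussianPDFReal m v) x) := by
    refine (((integrable_gaussianReal_iff hv).1 hprod).const_mul (-(v : ℝ)⁻¹)).congr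
      (ae_of_all _ fun x => ?_)
    simp only [hpdf]
    ring
  have hparts (t : ℝ) : ∫ x in -t..t, deriv f x * gaussianPDFReal m v x +
      f x * deriv (gaussianPDFReal m v) x =
      f t * gaussianPDFReal m v t - f (-t) * gaussianPDFReal m v (-t) :=
    AbsolutelyContinuousOnInterval.integral_deriv_mul_eq_sub
      hf.lipschitzOnWith.absolutelyContinuousOnInterval
      hsmooth.contDiffOn.absolutelyContinuousOnInterval
  have hlim := intervalIntegral_tendsto_integral (h1.add h2) tendsto_neg_atTop_atBot tendsto_id
  have hzero := tendsto_mul_gaussianPDFReal_cocompact m hv hf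
  have hlim0 := (hzero.mono_left atTop_le_cocompact).sub
    ((hzero.mono_left atBot_le_cocompact).comp tendsto_neg_atTop_atBot)
  have hsum : ∫ x, (deriv f x * gaussianPDFReal m v x +
      f x * deriv (gaussianPDFReal m v) x) = 0 := by
    rw [sub_zero] at hlim0
    exact tendsto_nhds_unique hlim (hlim0.congr fun t => (hparts t).symm)
  rw [integral_add h1 h2] at hsum
  have h3 : ∫ x, f x * deriv (gaussianPDFReal m v) x =
      -(v : ℝ)⁻¹ * ∫ x, f x * (x - m) ∂gaussianReal m v := by
    rw [integral_gaussianReal_eq_integral_smul hv, ← integral_const_mul]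
    refine integral_congr_ae (ae_of_all _ fun x => ?_)
    simp only [hpdf, smul_eq_mul]
    ring
  have h4 : ∫ x, deriv f x * gaussianPDFReal m v x = ∫ x, deriv f x ∂gaussianReal m v := by
    simp only [integral_gaussianReal_eq_integral_smul hv, smul_eq_mul, mul_comm]
  rw [h3, h4] at hsum
  field_simp at hsum
  linarith

/-- Resampling one coordinate from its own marginal preserves a product probability measure. -/
lemma measurePreserving_update_pi {ι : Type*} [Fintype ι] [DecidableEq ι] {α : ι → Type*}
    [∀ i, MeasurableSpace (α i)] (μ : ∀ i, Measure (α i)) [∀ i, IsProbabilityMeasure (μ i)]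
    (i : ι) :
    MeasurePreserving (fun p : (∀ j, α j) × α i => Function.update p.1 i p.2)
      ((Measure.pi μ).prod (μ i)) (Measure.pi μ) := by
  have hmeas : Measurable (fun p : (∀ j, α j) × α i => Function.update p.1 i p.2) :=
    measurable_update'
  refine ⟨hmeas, (Measure.pi_eq fun s hs => ?_).symm⟩
  have hpre : (fun p : (∀ j, α j) × α i => Function.update p.1 i p.2) ⁻¹' Set.univ.pi s =
      (Set.univ.pi (Function.update s i Set.univ)) ×ˢ s i := by
    ext ⟨y, t⟩
    simp only [Set.mem_preimage, Set.mem_pi, Set.mem_univ, true_implies, Set.mem_prod]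
    constructor
    · refine fun h => ⟨fun j => ?_, by simpa using h i⟩
      rcases eq_or_ne j i with rfl | hj
      · simp
      · simpa [hj] using h j
    · rintro ⟨h, ht⟩ j
      rcases eq_or_ne j i with rfl | hj
      · simpa using ht
      · simpa [hj] using h j
  rw [Measure.map_apply hmeas (MeasurableSet.univ_pi hs), hpre, Measure.prod_prod, Measure.pi_pi,
    ← Finset.mul_prod_erase _ _ (Finset.mem_univ i),
    ← Finset.mul_prod_erase _ (fun j => μ j (s j)) (Finset.mem_univ i), mul_comm]
  simp only [Function.update_self, measure_univ, one_mul]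
  congr 1
  refine Finset.prod_congr rfl fun j hj => ?_
  rw [Function.update_of_ne (Finset.ne_of_mem_erase hj)]

/-- Stein's identity in one coordinate direction for a Lipschitz function of independent Gaussian
variables. -/
lemma integral_mul_sub_pi_gaussianReal_of_lipschitzWith {ι : Type*} [Fintype ι] [DecidableEq ι]
    (m : ι → ℝ) {v : NNReal} (hv : v ≠ 0) {F F' : (ι → ℝ) → ℝ} {L : NNReal}
    (hF : LipschitzWith L F) (i : ι)
    (hderiv : ∀ᵐ y ∂Measure.pi fun j => gaussianReal (m j) v,
      HasDerivAt (fun s => F (Function.update y i s)) (F' y) (y i))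
    (hint : Integrable F' (Measure.pi fun j => gaussianReal (m j) v)) :
    ∫ y, F y * (y i - m i) ∂(Measure.pi fun j => gaussianReal (m j) v) =
      v * ∫ y, F' y ∂(Measure.pi fun j => gaussianReal (m j) v) := by
  set P := Measure.pi fun j => gaussianReal (m j) v
  have hmp : MeasurePreserving (fun p : (ι → ℝ) × ℝ => Function.update p.1 i p.2)
      (P.prod (gaussianReal (m i) v)) P :=
    measurePreserving_update_pi (fun j => gaussianReal (m j) v) i
  have hresample {G : (ι → ℝ) → ℝ} (hG : Integrable G P) :
      ∫ y, G y ∂P = ∫ y, ∫ s, G (Function.update y i s) ∂gaussianReal (m i) v ∂P := by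
    rw [← integral_prod (fun p : (ι → ℝ) × ℝ => G (Function.update p.1 i p.2))
      (hmp.integrable_comp_of_integrable hG)]
    have hG' := hG.aestronglyMeasurable
    rw [← hmp.map_eq] at hG'
    rw [← integral_map hmp.aemeasurable hG', hmp.map_eq]
  have hcoord (j : ι) : MemLp (fun y : ι → ℝ => y j) 2 P :=
    (memLp_id_gaussianReal' 2 (by simp)).comp_measurePreserving
      (measurePreserving_eval (fun j => gaussianReal (m j) v) j)
  have hFL : MemLp F 2 P := by
    refine ((memLp_const |F 0|).add
      ((memLp_finsetSum Finset.univ fun j _ => (hcoord j).norm).const_mul (L : ℝ))).mono'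
      hF.continuous.aestronglyMeasurable (ae_of_all _ fun y => ?_)
    have h := hF.dist_le_mul y 0
    rw [Real.dist_eq, dist_zero_right] at h
    have h0 := abs_sub_abs_le_abs_sub (F y) (F 0)
    have hnorm : ‖y‖ ≤ ∑ j, ‖y j‖ := (pi_norm_le_iff_of_nonneg (by positivity)).2 fun j =>
      Finset.single_le_sum (f := fun j => ‖y j‖) (fun _ _ => norm_nonneg _) (Finset.mem_univ j)
    have := mul_le_mul_of_nonneg_left hnorm L.coe_nonneg
    simp only [Pi.add_apply, Real.norm_eq_abs] at this ⊢
    linarith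
  have hprod : Integrable (fun y => F y * (y i - m i)) P :=
    hFL.integrable_mul ((hcoord i).sub (memLp_const (m i)))
  rw [hresample hprod, hresample hint, ← integral_const_mul]
  have hslice : ∀ᵐ y ∂P, ∀ᵐ s ∂gaussianReal (m i) v,
      HasDerivAt (fun t => F (Function.update y i t)) (F' (Function.update y i s)) s := by
    have h := Measure.ae_ae_of_ae_prod (hmp.quasiMeasurePreserving.ae hderiv)
    simpa only [Function.update_idem, Function.update_self] using h
  refine integral_congr_ae ?_
  filter_upwards [hslice] with y hy
  have hlip : LipschitzWith L fun s => F (Function.update y i s) := by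
    refine LipschitzWith.of_dist_le_mul fun s t => (hF.dist_le_mul _ _).trans ?_
    refine mul_le_mul_of_nonneg_left ((dist_pi_le_iff dist_nonneg).2 fun j => ?_) L.coe_nonneg
    rcases eq_or_ne j i with rfl | hj
    · simp
    · simp [hj]
  have h := integral_mul_sub_gaussianReal_of_lipschitzWith (m i) hv hlip
  simp only [Function.update_self]
  rw [h]
  congr 1
  refine integral_congr_ae ?_
  filter_upwards [hy] with s hs using hs.deriv

theorem stmt7 (n : ℕ) (μv : Fin n → ℝ) (v : NNReal) (hv : 0 < v)
    (g : (Fin n → ℝ) → (Fin n → ℝ)) (L : NNReal) (hLip : LipschitzWith L g)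
    (g' : (Fin n → ℝ) → Fin n → ℝ)
    (P : Measure (Fin n → ℝ))
    (hP : P = Measure.pi fun i => gaussianReal (μv i) v)
    (hderiv : ∀ᵐ y ∂P, ∀ i,
      HasDerivAt (fun s => g (Function.update y i s) i) (g' y i) (y i))
    (hint : ∀ i, Integrable (fun y => g' y i) P) :
    ∑ i, (∫ y, (g y i - ∫ y', g y' i ∂P) * (y i - μv i) ∂P) / (v : ℝ) =
      ∫ y, ∑ i, g' y i ∂P := by
  have hv0 : (v : ℝ) ≠ 0 := NNReal.coe_ne_zero.2 hv.ne'
  rw [integral_finsetSum _ fun i _ => hint i]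
  refine Finset.sum_congr rfl fun i _ => ?_
  have hcenter : LipschitzWith L fun y => g y i - ∫ y', g y' i ∂P := by
    refine LipschitzWith.of_dist_le_mul fun x y => ?_
    rw [dist_sub_right]
    exact (dist_le_pi_dist (g x) (g y) i).trans (hLip.dist_le_mul x y)
  have hd : ∀ᵐ y ∂P, HasDerivAt (fun s => g (Function.update y i s) i - ∫ y', g y' i ∂P)
      (g' y i) (y i) := by
    filter_upwards [hderiv] with y hy using (hy i).sub_const _
  have h := integral_mul_sub_pi_gaussianReal_of_lipschitzWith μv hv.ne' hcenter i
    (hP ▸ hd) (hP ▸ hint i)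
  rw [← hP] at h
  rw [h, mul_div_cancel_left₀ _ hv0]
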